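/- Assume [B_δ, B_{kδ}] = 0 for all k < n and the commutator formula for [B_{(n−1)δ},B_0] from Lemma 5.6 (i.e., [B_{mδ},B_0] = c[2]_q q^{−2(m−1)}(B_{mδ+α_0} − B_{(m−1)δ+α_1}) − (q⁴−1)Σ_{p=1}^{m−1} q^{−2p}(B_{pδ+α_0}B_{(m−p)δ} − B_{(m−p)δ}B_{(p−1)δ+α_1}) for m < n). Then [B_{nδ}, B_0] satisfies the recursion [B_{nδ},B_0] = q^{-2}[B_{(n−1)δ}, B_{δ+α_0}] − [B_{(n−2)δ}, B_0] − q^{-2}[B_1, B_{(n−1)δ}] + (q²−q^{-2})(B_{(n−1)δ}B_1 − B_{δ+α_0}B_{(n−1)δ}). -/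

import Mathlib

set_option synthInstance.maxHeartbeats 1000000
set_option maxHeartbeats 1000000

noncomputable section

open scoped BigOperators

/-- The field `ℚ(q)` of rational functions. -/
abbrev KK : Type := RatFunc ℚ

/-- The indeterminate `q ∈ ℚ(q)`. -/
def qq : KK := RatFunc.X

/-- The `q`-Dolan–Grady relations defining the `q`-Onsager algebra `B_c`:
`Σᵢ (−1)ⁱ [3 choose i]_q B₀^{3−i} B₁ B₀^i = −qc(q+q⁻¹)²(B₀B₁ − B₁B₀)` and the
same with `B₀, B₁` interchanged (here `[3 choose 1]_q = [3 choose 2]_q = q² + 1 + q⁻²`). -/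
inductive qOnsRel (c : KK) : FreeAlgebra KK (Fin 2) → FreeAlgebra KK (Fin 2) → Prop
  | r0 : qOnsRel c
      (FreeAlgebra.ι KK (0 : Fin 2) ^ 3 * FreeAlgebra.ι KK (1 : Fin 2)
        - (qq ^ 2 + 1 + (qq⁻¹) ^ 2) • (FreeAlgebra.ι KK (0 : Fin 2) ^ 2 * FreeAlgebra.ι KK (1 : Fin 2) * FreeAlgebra.ι KK (0 : Fin 2))
        + (qq ^ 2 + 1 + (qq⁻¹) ^ 2) • (FreeAlgebra.ι KK (0 : Fin 2) * FreeAlgebra.ι KK (1 : Fin 2) * FreeAlgebra.ι KK (0 : Fin 2) ^ 2)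
        - FreeAlgebra.ι KK (1 : Fin 2) * FreeAlgebra.ι KK (0 : Fin 2) ^ 3)
      ((-(qq * c * (qq + qq⁻¹) ^ 2)) •
        (FreeAlgebra.ι KK (0 : Fin 2) * FreeAlgebra.ι KK (1 : Fin 2) - FreeAlgebra.ι KK (1 : Fin 2) * FreeAlgebra.ι KK (0 : Fin 2)))
  | r1 : qOnsRel c
      (FreeAlgebra.ι KK (1 : Fin 2) ^ 3 * FreeAlgebra.ι KK (0 : Fin 2)
        - (qq ^ 2 + 1 + (qq⁻¹) ^ 2) • (FreeAlgebra.ι KK (1 : Fin 2) ^ 2 * FreeAlgebra.ι KK (0 : Fin 2) * FreeAlgebra.ι KK (1 : Fin 2))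
        + (qq ^ 2 + 1 + (qq⁻¹) ^ 2) • (FreeAlgebra.ι KK (1 : Fin 2) * FreeAlgebra.ι KK (0 : Fin 2) * FreeAlgebra.ι KK (1 : Fin 2) ^ 2)
        - FreeAlgebra.ι KK (0 : Fin 2) * FreeAlgebra.ι KK (1 : Fin 2) ^ 3)
      ((-(qq * c * (qq + qq⁻¹) ^ 2)) •
        (FreeAlgebra.ι KK (1 : Fin 2) * FreeAlgebra.ι KK (0 : Fin 2) - FreeAlgebra.ι KK (0 : Fin 2) * FreeAlgebra.ι KK (1 : Fin 2)))

/-- The `q`-Onsager algebra `B_c`. -/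
abbrev QOns (c : KK) : Type := RingQuot (qOnsRel c)

/-- The generator `B₀` of `B_c`. -/
def Bo (c : KK) : QOns c := RingQuot.mkAlgHom KK (qOnsRel c) (FreeAlgebra.ι KK (0 : Fin 2))

/-- The generator `B₁` of `B_c`. -/
def Bi (c : KK) : QOns c := RingQuot.mkAlgHom KK (qOnsRel c) (FreeAlgebra.ι KK (1 : Fin 2))

/-- `B_δ = −B₀B₁ + q⁻²B₁B₀`. -/
def Bdel (c : KK) : QOns c := -(Bo c * Bi c) + ((qq⁻¹) ^ 2) • (Bi c * Bo c)

/-- `B̃_δ = −B₁B₀ + q⁻²B₀B₁`. -/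
def tBdel (c : KK) : QOns c := -(Bi c * Bo c) + ((qq⁻¹) ^ 2) • (Bo c * Bi c)

/-- The formula for `T₀(B₁)`:
`(1/(q²[2]_q c))(B₁B₀² − q[2]_q B₀B₁B₀ + q²B₀²B₁) + B₁`. -/
def T0B1val (c : KK) : QOns c :=
  (qq ^ 2 * (qq + qq⁻¹) * c)⁻¹ •
    (Bi c * Bo c ^ 2 - (qq * (qq + qq⁻¹)) • (Bo c * Bi c * Bo c) + qq ^ 2 • (Bo c ^ 2 * Bi c))
    + Bi c

/-- The formula for `T₀⁻¹(B₁)`: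
`(1/(q²[2]_q c))(B₀²B₁ − q[2]_q B₀B₁B₀ + q²B₁B₀²) + B₁`. -/
def T0invB1val (c : KK) : QOns c :=
  (qq ^ 2 * (qq + qq⁻¹) * c)⁻¹ •
    (Bo c ^ 2 * Bi c - (qq * (qq + qq⁻¹)) • (Bo c * Bi c * Bo c) + qq ^ 2 • (Bi c * Bo c ^ 2))
    + Bi c

/-- `T₁ = Φ ∘ T₀ ∘ Φ`. -/
def T1def (c : KK) (Φ T0 : QOns c ≃ₐ[KK] QOns c) : QOns c ≃ₐ[KK] QOns c :=
  Φ.trans (T0.trans Φ)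

/-- The real root vectors `B_{nδ+α₀} = (T₀Φ)ⁿ(B₀)` for `n ≥ 0`. -/
def Ba0 (c : KK) (Φ T0 : QOns c ≃ₐ[KK] QOns c) (n : ℕ) : QOns c :=
  ((⇑T0 ∘ ⇑Φ)^[n]) (Bo c)

/-- The real root vectors `B_{nδ+α₁} = (T₁⁻¹Φ)ⁿ(B₁)` for `n ≥ 0`. -/
def Ba1 (c : KK) (Φ T0 : QOns c ≃ₐ[KK] QOns c) (n : ℕ) : QOns c :=
  ((⇑(T1def c Φ T0).symm ∘ ⇑Φ)^[n]) (Bi c)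

/-- `B_{kδ+α₁}` for `k ∈ ℤ`, with the convention `B_{kδ+α₁} = B_{(−k−1)δ+α₀}` for `k < 0`. -/
def Ba1Z (c : KK) (Φ T0 : QOns c ≃ₐ[KK] QOns c) (k : ℤ) : QOns c :=
  if 0 ≤ k then Ba1 c Φ T0 k.toNat else Ba0 c Φ T0 (-k - 1).toNat

/-- `B_{kδ+α₀}` for `k ∈ ℤ`, with the convention `B_{kδ+α₀} = B_{(−k−1)δ+α₁}` for `k < 0`. -/
def Ba0Z (c : KK) (Φ T0 : QOns c ≃ₐ[KK] QOns c) (k : ℤ) : QOns c :=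
  if 0 ≤ k then Ba0 c Φ T0 k.toNat else Ba1 c Φ T0 (-k - 1).toNat

/-- `C_m = Σ_{p=0}^{m−2} B_{pδ+α₁} B_{(m−p−2)δ+α₁}` (so `C₀ = C₁ = 0`). -/
def CC (c : KK) (Φ T0 : QOns c ≃ₐ[KK] QOns c) (m : ℕ) : QOns c :=
  ∑ p ∈ Finset.range (m - 1), Ba1 c Φ T0 p * Ba1 c Φ T0 (m - 2 - p)

/-- The imaginary root vectors
`B_{mδ} = −B₀B_{(m−1)δ+α₁} + q⁻²B_{(m−1)δ+α₁}B₀ + (q⁻²−1)C_m` for `m ≥ 1`. -/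
def Bim (c : KK) (Φ T0 : QOns c ≃ₐ[KK] QOns c) (m : ℕ) : QOns c :=
  -(Bo c * Ba1 c Φ T0 (m - 1)) + ((qq⁻¹) ^ 2) • (Ba1 c Φ T0 (m - 1) * Bo c)
    + (((qq⁻¹) ^ 2 - 1)) • CC c Φ T0 m


section Abstract

variable {K A : Type*} [Field K] [CharZero K] [Ring A] [Algebra K A]

/-- The quadratic expression `S(r,s)` in the real root vectors. -/
def SS (t : K) (x : ℤ → A) (r s : ℤ) : A :=
  -(x r * x s) + t • (x s * x r) - x (s - 1) * x (r + 1) + t • (x (r + 1) * x (s - 1))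

theorem cubic_free (t : K) (a0 a1 a2 b0 b1 b2 c0 c1 c2 : A) (p : A → A → A → A → A)
    (hp : ∀ u u' v v', p u u' v v' = u' * v - t • (u * v') + v' * u - t • (v * u')) :
    (p a1 a2 b1 b2 * c0 - t • ((p a1 a2 b0 b1 + p a0 a1 b1 b2) * c1) + (t*t) • (p a0 a1 b0 b1 * c2)
      - (t*t) • (c0 * p a1 a2 b1 b2) + t • (c1 * (p a1 a2 b0 b1 + p a0 a1 b1 b2))
      - c2 * p a0 a1 b0 b1)
    + (p a1 a2 c1 c2 * b0 - t • ((p a1 a2 c0 c1 + p a0 a1 c1 c2) * b1) + (t*t) • (p a0 a1 c0 c1 * b2)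
      - (t*t) • (b0 * p a1 a2 c1 c2) + t • (b1 * (p a1 a2 c0 c1 + p a0 a1 c1 c2))
      - b2 * p a0 a1 c0 c1)
    + (p b1 b2 c1 c2 * a0 - t • ((p b1 b2 c0 c1 + p b0 b1 c1 c2) * a1) + (t*t) • (p b0 b1 c0 c1 * a2)
      - (t*t) • (a0 * p b1 b2 c1 c2) + t • (a1 * (p b1 b2 c0 c1 + p b0 b1 c1 c2))
      - a2 * p b0 b1 c0 c1) = 0 := by
  simp only [hp, mul_add, add_mul, mul_sub, sub_mul, smul_add, smul_sub, mul_smul_comm,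
    smul_mul_assoc, mul_assoc, smul_smul]
  module

/-- The mixed commutation expression. -/
def MM (t : K) (x : ℤ → A) (s s' : A) (r : ℤ) : A :=
  s * x (r + 1) - t • (s' * x r) + (t*t) • (s * x (r - 1))
    - (t*t) • (x (r + 1) * s) + t • (x r * s') - x (r - 1) * s

theorem SS_symm (t : K) (x : ℤ → A) (r s : ℤ) : SS t x (s - 1) (r + 1) = SS t x r s := by
  simp only [SS, sub_add_cancel, add_sub_cancel_right]
  abel

theorem cubic (t : K) (x : ℤ → A) (a b c : ℤ) :
    MM t x (SS t x (a-2) (b-1)) (SS t x (a-2) b + SS t x (a-1) (b-1)) (c-1)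
    + MM t x (SS t x (a-2) (c-1)) (SS t x (a-2) c + SS t x (a-1) (c-1)) (b-1)
    + MM t x (SS t x (b-2) (c-1)) (SS t x (b-2) c + SS t x (b-1) (c-1)) (a-1)
    + (MM t x (SS t x (a-1) b - SS t x (a-2) (b-1)) 0 (c-1) - 
        (SS t x (a-1) b - SS t x (a-2) (b-1)) * x c + (t*t) • (x c * (SS t x (a-1) b - SS t x (a-2) (b-1))))
    + (MM t x (SS t x (a-1) c - SS t x (a-2) (c-1)) 0 (b-1) - 
        (SS t x (a-1) c - SS t x (a-2) (c-1)) * x b + (t*t) • (x b * (SS t x (a-1) c - SS t x (a-2) (c-1))))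
    + (MM t x (SS t x (b-1) c - SS t x (b-2) (c-1)) 0 (a-1) - 
        (SS t x (b-1) c - SS t x (b-2) (c-1)) * x a + (t*t) • (x a * (SS t x (b-1) c - SS t x (b-2) (c-1)))) = 0 := by
  have h := cubic_free t (x a) (x (a-1)) (x (a-2)) (x b) (x (b-1)) (x (b-2))
    (x c) (x (c-1)) (x (c-2)) _ (fun _ _ _ _ => rfl)
  have e1 : ∀ z : ℤ, z - 1 - 1 = z - 2 := fun z => by ring
  have e2 : ∀ z : ℤ, z - 2 + 1 = z - 1 := fun z => by ring
  have e3 : ∀ z : ℤ, z - 1 + 1 = z := fun z => by ring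
  rw [← neg_eq_zero, ← h]
  simp only [MM, SS, e1, e2, e3]
  simp only [mul_add, add_mul, mul_sub, sub_mul, smul_add, smul_sub, mul_smul_comm,
    smul_mul_assoc, mul_assoc, smul_smul, mul_neg, neg_mul, smul_neg, mul_zero, zero_mul]
  module

theorem abstract_main (t e : K) (he : e ≠ 0) (x : ℤ → A) (σ : A ≃ₐ[K] A) (d : A) (F : ℕ → A) (n : ℕ)
    (hn : 3 ≤ n) (hσ : ∀ k, σ (x k) = x (k + 1))
    (hd : ∀ k, d * x k - x k * d = e • (x (k - 1) - x (k + 1)))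
    (hF0 : F 0 = 0) (hF1 : (2 : K) • F 1 = SS t x (-1) 0)
    (hF : ∀ m : ℕ, F (m + 2) = SS t x (-1) ((m : ℤ) + 1) + σ (F m))
    (hσ1 : σ (F 1) = F 1)
    (hcom : ∀ k, 1 ≤ k → k < n → d * F k - F k * d = 0) :
    t • ((F n + F (n-2)) * x (-1) - x (-1) * (F n + F (n-2))) =
      F (n-1) * x 0 - (t*t) • (x 0 * F (n-1)) + (t*t) • (F (n-1) * x (-2)) - x (-2) * F (n-1) := by
  have hσS : ∀ r s, σ (SS t x r s) = SS t x (r + 1) (s + 1) := by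
    intro r s
    have e1 : s - 1 + 1 = s + 1 - 1 := by ring
    simp only [SS, map_add, map_sub, map_neg, map_mul, map_smul, hσ, e1]
  have hdS : ∀ r s, d * SS t x r s - SS t x r s * d =
      e • (SS t x (r-1) s + SS t x r (s-1) - SS t x (r+1) s - SS t x r (s+1)) := by
    intro r s
    have hD : ∀ i j, d * (x i * x j) = x i * (x j * d) + e • ((x (i - 1) - x (i + 1)) * x j)
        + e • (x i * (x (j-1) - x (j+1))) := by
      intro i j
      rw [← smul_mul_assoc, ← hd, ← mul_smul_comm, ← hd]
      noncomm_ring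
    have e1 : s - 1 + 1 = s := by ring
    have e2 : s + 1 - 1 = s := by ring
    have e3 : r - 1 + 1 = r := by ring
    have e4 : r + 1 - 1 = r := by ring
    simp only [SS, mul_add, add_mul, mul_sub, sub_mul, mul_neg, neg_mul, mul_smul_comm,
      smul_mul_assoc, mul_assoc, hD, e1, e2, e3, e4]
    simp only [smul_add, smul_sub, smul_neg, smul_smul]
    module
  have hcom' : ∀ k, k < n → d * F k - F k * d = 0 := by
    intro k hk
    rcases Nat.eq_zero_or_pos k with rfl | h
    · simp [hF0]
    · exact hcom k h hk
  -- invariance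
  have inv : ∀ j : ℕ, j + 1 ≤ n → σ (F j) = F j ∧ σ (F (j+1)) = F (j+1) ∧
      SS t x 0 ((j:ℤ) + 1) = SS t x (-1) (j:ℤ) := by
    intro j
    induction j using Nat.strong_induction_on with
    | _ j ih =>
    intro hj
    match j, ih, hj with
    | 0, _, _ =>
      refine ⟨by simp [hF0], hσ1, ?_⟩
      have := hσS (-1) 0
      rw [← hF1, map_smul, hσ1, hF1] at this
      simpa using this.symm
    | 1, ih, hj =>
      have key : SS t x 0 2 = SS t x (-1) 1 := by
        have h1 := hdS (-1) 0
        rw [← hF1, mul_smul_comm, smul_mul_assoc, ← smul_sub, hcom' 1 (by omega), smul_zero] at h1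
        have h2 := (smul_eq_zero.mp h1.symm).resolve_left he
        have h3 := SS_symm t x (-1) (-1)
        have h4 := congrArg σ h2
        simp only [map_sub, map_add, map_zero, hσS] at h4
        have h5 := SS_symm t x 0 0
        norm_num at h4 h5
        have h6 : (2:K) • (SS t x (-1) 1 - SS t x 0 2) = 0 := by
          rw [← h4]
          have h7 := SS_symm t x 1 1
          norm_num at h7
          rw [← h5, h7]
          module
        exact (sub_eq_zero.mp ((smul_eq_zero.mp h6).resolve_left two_ne_zero)).symm
      refine ⟨hσ1, ?_, by simpa using key⟩
      have := hF 0
      simp only [hF0, map_zero, add_zero] at this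
      simp only [Nat.reduceAdd, zero_add, Nat.cast_zero] at this ⊢
      rw [this, hσS]
      simpa using key
    | (i+2), ih, hj =>
      obtain ⟨h0, h1, h2⟩ := ih i (by omega) (by omega)
      obtain ⟨h0', h1', h2'⟩ := ih (i+1) (by omega) (by omega)
      have h3 := hF i
      rw [h0] at h3
      have h3' : SS t x (-1) ((i:ℤ)+1) = F (i+2) - F i := by rw [h3]; abel
      have h4 := hdS (-1) ((i:ℤ)+1)
      rw [h3'] at h4
      have h5 : d * (F (i+2) - F i) - (F (i+2) - F i) * d = 0 := by
        have ha := hcom' (i+2) (by omega)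
        have hb := hcom' i (by omega)
        calc _ = (d * F (i+2) - F (i+2) * d) - (d * F i - F i * d) := by noncomm_ring
          _ = 0 := by rw [ha, hb, sub_zero]
      rw [h5] at h4
      have h6 := congrArg σ ((smul_eq_zero.mp h4.symm).resolve_left he)
      simp only [map_sub, map_add, map_zero, hσS] at h6
      have e0 : (-1:ℤ) + 1 = 0 := by norm_num
      have e1 : (-1:ℤ) - 1 + 1 = -1 := by norm_num
      have e2 : (i:ℤ) + 1 - 1 + 1 = i + 1 := by ring
      have e3 : (i:ℤ) + 1 + 1 = i + 2 := by ring
      have h7 := congrArg σ h2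
      rw [hσS, hσS] at h7
      simp only [e0, e1, e2, e3] at h6 h7
      have key : SS t x 0 ((i:ℤ)+2+1) = SS t x (-1) ((i:ℤ)+2) := by
        rw [← sub_eq_zero, ← neg_eq_zero, ← h6, h7]
        abel
      refine ⟨h1', ?_, by push_cast; exact key⟩
      have h8 := hF (i+1)
      rw [h1] at h8
      rw [h8, map_add, h1, hσS]
      push_cast
      have e4 : (i:ℤ) + 1 + 1 + 1 = i + 2 + 1 := by ring
      have e5 : (i:ℤ) + 1 + 1 = i + 2 := by ring
      rw [e4, e5, key]
  have shift : ∀ k : ℕ, k + 1 ≤ n → ∀ r s : ℤ, s - r = k + 1 → SS t x r s = SS t x (-1) (k:ℤ) := by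
    intro k hk
    have h0 := (inv k hk).2.2
    have step : ∀ r : ℤ, SS t x r (r + (k+1)) = SS t x (-1) (k:ℤ) := by
      have hup : ∀ r : ℤ, σ (SS t x r (r + (k+1))) = SS t x (r+1) (r + 1 + (k+1)) := by
        intro r; rw [hσS]; congr 1; ring
      have h0' : σ (SS t x (-1) (k:ℤ)) = SS t x (-1) (k:ℤ) := by
        rw [hσS]; simpa using h0
      intro r
      induction r using Int.induction_on with
      | zero => rw [← h0]; congr 1; ring
      | succ i ih => rw [← hup, ih, h0']
      | pred i ih =>
        apply σ.injective
        rw [hup, h0', ← ih]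
        simp
    intro r s hrs
    rw [← step r]; congr 1; linarith
  -- the mixed relations
  have M0 : ∀ r : ℤ, MM t x (SS t x (-1) 0) (SS t x (-1) 1 + SS t x (-1) 1) r = 0 := by
    intro r
    have h := cubic t x (r+1) (r+1) (r+1)
    have a1 := shift 0 (by omega) (r+1-2) (r+1-1) (by push_cast; ring)
    have a2 := shift 1 (by omega) (r+1-2) (r+1) (by push_cast; ring)
    have a3 := shift 0 (by omega) (r+1-1) (r+1) (by push_cast; ring)
    have a4 := SS_symm t x (r+1-1) (r+1-1)
    have e1 : r + 1 - 1 - 1 = r + 1 - 2 := by ring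
    have e2 : r + 1 - 1 + 1 = r + 1 := by ring
    rw [e1, e2] at a4
    rw [← a4, a3, a1, a2] at h
    simp only [add_sub_cancel_right, sub_self, Nat.cast_zero, Nat.cast_one] at h
    have h0 : MM t x 0 0 r = 0 := by simp [MM]
    simp only [h0, zero_mul, mul_zero, smul_zero, sub_zero, add_zero] at h
    have h3 : (3:K) • MM t x (SS t x (-1) 0) (SS t x (-1) 1 + SS t x (-1) 1) r = 0 := by
      rw [← h]; module
    exact (smul_eq_zero.mp h3).resolve_left three_ne_zero
  have M1 : ∀ k : ℕ, k + 3 ≤ n → MM t x (SS t x (-1) ((k:ℤ)+1))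
      (SS t x (-1) ((k:ℤ)+2) + SS t x (-1) (k:ℤ)) (-1) = 0 := by
    intro k hk
    have h := cubic t x 0 0 ((k:ℤ)+1)
    have a1 := shift 0 (by omega) (0-2) (0-1) (by norm_num)
    have a2 := shift 1 (by omega) (0-2) (0) (by norm_num)
    have a3 := shift 0 (by omega) (0-1) (0) (by norm_num)
    have a4 := SS_symm t x (0-1) (0-1)
    have e1 : (0:ℤ) - 1 - 1 = 0 - 2 := by ring
    have e2 : (0:ℤ) - 1 + 1 = 0 := by ring
    rw [e1, e2] at a4
    have b1 := shift (k+1) (by omega) (0-2) ((k:ℤ)+1-1) (by push_cast; ring)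
    have b2 := shift (k+1) (by omega) (0-1) ((k:ℤ)+1) (by push_cast; ring)
    have b3 := shift (k+2) (by omega) (0-2) ((k:ℤ)+1) (by push_cast; ring)
    have b4 := shift k (by omega) (0-1) ((k:ℤ)+1-1) (by push_cast; ring)
    rw [← a4, a3, a1, a2, b1, b2, b3, b4] at h
    have h0 : ∀ r, MM t x 0 0 r = 0 := by intro r; simp [MM]
    simp only [sub_self, Nat.cast_zero, Nat.cast_one, h0, zero_mul, mul_zero, smul_zero,
      sub_zero, add_zero, M0, zero_add, zero_sub] at h
    push_cast at h
    have h3 : (2:K) • MM t x (SS t x (-1) ((k:ℤ)+1))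
      (SS t x (-1) ((k:ℤ)+2) + SS t x (-1) (k:ℤ)) (-1) = 0 := by
      rw [← h]; module
    exact (smul_eq_zero.mp h3).resolve_left two_ne_zero
  have hS : ∀ m : ℕ, m + 1 ≤ n → SS t x (-1) ((m:ℤ)+1) = F (m+2) - F m := by
    intro m hm
    rw [hF m, (inv m hm).1]; abel
  have MMadd : ∀ a a' b b' r, MM t x (a - b) (a' - b') r = MM t x a a' r - MM t x b b' r := by
    intro a a' b b' r
    simp only [MM, mul_sub, sub_mul, smul_sub]
    module
  have W : ∀ k : ℕ, k + 2 ≤ n → MM t x (F (k+1)) (F (k+2) + F k) (-1) = 0 := by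
    intro k
    induction k using Nat.strong_induction_on with
    | _ k ih =>
    intro hk
    match k, ih, hk with
    | 0, _, _ =>
      have h := M0 (-1)
      have h1 := hS 0 (by omega)
      simp only [Nat.cast_zero, zero_add, hF0, sub_zero] at h1
      rw [h1, ← hF1] at h
      have h3 : (2:K) • MM t x (F (0+1)) (F (0+2) + F 0) (-1) = 0 := by
        rw [← h]
        simp only [MM, hF0, add_zero, zero_add, smul_mul_assoc, mul_smul_comm, mul_add, add_mul]
        module
      exact (smul_eq_zero.mp h3).resolve_left two_ne_zero
    | 1, _, hk =>
      have h := M1 0 (by omega)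
      have h1 := hS 0 (by omega)
      have h2 := hS 1 (by omega)
      simp only [Nat.cast_zero, Nat.cast_one, zero_add, hF0, sub_zero] at h h1 h2
      have e : (1:ℤ) + 1 = 2 := by norm_num
      rw [e] at h2
      rw [h1, h2, ← hF1] at h
      have e2 : F (1+2) - F 1 + (2:K) • F 1 = F (1+2) + F 1 := by module
      rw [e2] at h
      exact h
    | (i+2), ih, hk =>
      have h := M1 (i+1) (by omega)
      have h1 := hS (i+1) (by omega)
      have h2 := hS (i+2) (by omega)
      have h3 := hS i (by omega)
      have hi := ih i (by omega) (by omega)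
      push_cast at h h1 h2
      have e : (i:ℤ) + 1 + 2 = i + 2 + 1 := by ring
      rw [e, h1, h2, h3] at h
      have e2 : F (i+2+2) - F (i+2) + (F (i+2) - F i) = (F (i+2+2) + F (i+2)) - (F (i+2) + F i) := by
        abel
      rw [e2, MMadd, hi, sub_zero] at h
      exact h
  obtain ⟨m, rfl⟩ : ∃ m, n = m + 2 := ⟨n - 2, by omega⟩
  have h := W m le_rfl
  simp only [MM] at h
  norm_num at h
  have e1 : m + 2 - 2 = m := by omega
  have e2 : m + 2 - 1 = m + 1 := by omega
  rw [e1, e2, ← sub_eq_zero, ← neg_eq_zero, ← h]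
  simp only [smul_sub]
  abel

end Abstract

theorem qq_ne : qq ≠ 0 := RatFunc.X_ne_zero

theorem qq_sum_ne : qq + qq⁻¹ ≠ 0 := by
  intro h
  have h1 : qq ^ 2 + 1 = 0 := by
    have : qq * (qq + qq⁻¹) = 0 := by rw [h, mul_zero]
    rw [mul_add, mul_inv_cancel₀ qq_ne] at this
    rw [← this]; ring
  have h2 : algebraMap (Polynomial ℚ) KK (Polynomial.X ^ 2 + 1) = 0 := by
    rw [← h1]; simp [qq, RatFunc.algebraMap_X]
  have h3 := (map_eq_zero_iff _ (RatFunc.algebraMap_injective ℚ)).mp h2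
  have h4 := congrArg (Polynomial.eval 0) h3
  simp at h4

theorem rel0 (c : KK) : Bo c ^ 3 * Bi c
        - (qq ^ 2 + 1 + (qq⁻¹) ^ 2) • (Bo c ^ 2 * Bi c * Bo c)
        + (qq ^ 2 + 1 + (qq⁻¹) ^ 2) • (Bo c * Bi c * Bo c ^ 2)
        - Bi c * Bo c ^ 3 = (-(qq * c * (qq + qq⁻¹) ^ 2)) • (Bo c * Bi c - Bi c * Bo c) := by
  have h := RingQuot.mkAlgHom_rel KK (qOnsRel.r0 (c := c))
  simp only [map_add, map_sub, map_mul, map_pow, map_smul] at h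
  exact h

theorem tau_del_aux {K A : Type*} [Field K] [Ring A] [Algebra K A] (qq : K) (hq : qq ≠ 0) (hs : qq + qq⁻¹ ≠ 0) (c : K) (hc : c ≠ 0) (a b : A)
    (h : a ^ 3 * b
        - (qq ^ 2 + 1 + (qq⁻¹) ^ 2) • (a ^ 2 * b * a)
        + (qq ^ 2 + 1 + (qq⁻¹) ^ 2) • (a * b * a ^ 2)
        - b * a ^ 3 = (-(qq * c * (qq + qq⁻¹) ^ 2)) • (a * b - b * a)) (v : A)
    (hv : v = (qq ^ 2 * (qq + qq⁻¹) * c)⁻¹ •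
    (b * a ^ 2 - (qq * (qq + qq⁻¹)) • (a * b * a) + qq ^ 2 • (a ^ 2 * b)) + b) :
    -(v * a) + ((qq⁻¹) ^ 2) • (a * v) = -(a * b) + ((qq⁻¹) ^ 2) • (b * a) := by
  have hs' : qq ^ 2 + 1 ≠ 0 := by
    intro h0; apply hs; field_simp; simpa using h0
  have h2 : b * a ^ 3 = a ^ 3 * b
        - (qq ^ 2 + 1 + (qq⁻¹) ^ 2) • (a ^ 2 * b * a)
        + (qq ^ 2 + 1 + (qq⁻¹) ^ 2) • (a * b * a ^ 2)
        - (-(qq * c * (qq + qq⁻¹) ^ 2)) • (a * b - b * a) := by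
    rw [← h]; abel
  rw [hv]
  simp only [pow_succ, pow_zero, one_mul, mul_assoc, mul_add, add_mul, mul_sub, sub_mul, smul_add,
    smul_sub, mul_smul_comm, smul_mul_assoc, smul_smul] at h2 ⊢
  rw [h2]
  simp only [smul_add, smul_sub, smul_smul]
  match_scalars <;> field_simp <;> ring

theorem del_aux {K A : Type*} [Field K] [Ring A] [Algebra K A] (qq : K) (hq : qq ≠ 0) (hs : qq + qq⁻¹ ≠ 0) (c : K) (hc : c ≠ 0) (a b : A) (v : A)
    (hv : v = (qq ^ 2 * (qq + qq⁻¹) * c)⁻¹ •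
    (b * a ^ 2 - (qq * (qq + qq⁻¹)) • (a * b * a) + qq ^ 2 • (a ^ 2 * b)) + b) :
    (-(a * b) + ((qq⁻¹) ^ 2) • (b * a)) * a - a * (-(a * b) + ((qq⁻¹) ^ 2) • (b * a))
      = (c * (qq + qq⁻¹)) • (v - b) := by
  have hs' : qq ^ 2 + 1 ≠ 0 := by
    intro h0; apply hs; field_simp; simpa using h0
  rw [hv]
  simp only [pow_succ, pow_zero, one_mul, mul_assoc, mul_add, add_mul, mul_sub, sub_mul, smul_add,
    smul_sub, mul_smul_comm, smul_mul_assoc, smul_smul, mul_neg, neg_mul]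
  match_scalars <;> field_simp <;> ring

theorem C_rec {A : Type*} [Ring A] (y : ℕ → A) (m : ℕ) :
    ∑ p ∈ Finset.range (m + 2), y p * y (m + 1 - p) =
      y 0 * y (m + 1) + y (m + 1) * y 0
        + ∑ p ∈ Finset.range m, y (p + 1) * y (m - 1 - p + 1) := by
  rw [Finset.sum_range_succ, Finset.sum_range_succ']
  have : ∑ p ∈ Finset.range m, y (p + 1) * y (m + 1 - (p + 1)) =
      ∑ p ∈ Finset.range m, y (p + 1) * y (m - 1 - p + 1) := by
    apply Finset.sum_congr rfl
    intro p hp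
    have := Finset.mem_range.mp hp
    congr 2; omega
  rw [this]
  simp only [Nat.sub_zero, Nat.sub_self]
  abel

theorem fin_aux {K A : Type*} [Field K] [Ring A] [Algebra K A] (u t : K) (hut : u * t = 1)
    (fn f1 f2 b z w : A)
    (main : t • ((fn + f2) * b - b * (fn + f2)) =
      f1 * z - (t*t) • (z * f1) + (t*t) • (f1 * w) - w * f1) :
    fn * b - b * fn = t • (f1 * w - w * f1) - (f2 * b - b * f2) - t • (z * f1 - f1 * z)
      + (u - t) • (f1 * z - w * f1) := by
  have main2 := congrArg (fun y => u • y) main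
  have hutt : u * (t * t) = t := by rw [← mul_assoc, hut, one_mul]
  simp only [smul_add, smul_sub, smul_smul, hut, hutt, one_smul, add_mul, mul_add] at main2
  rw [← sub_eq_zero] at main2 ⊢
  rw [← main2]
  module

theorem F1_aux {K A : Type*} [Field K] [Ring A] [Algebra K A] (t : K) (a b : A) :
    (2:K) • (-a + t • b) = -a + t • b - a + t • b := by
  module

theorem F2_aux {K A : Type*} [Field K] [Ring A] [Algebra K A] (t : K) (a b d : A) :
    -a + t • b + (t - 1) • d = -a + t • b - d + t • d := by
  module

theorem F3_aux {K A : Type*} [Field K] [Ring A] [Algebra K A] (t : K) (a b d e s : A) :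
    -a + t • b + (t - 1) • (d + e + s) =
      -a + t • b - e + t • d + (-d + t • e + (t - 1) • s) := by
  module

/-- The recursion for `[B_{nδ},B₀]`, where `B_{δ+α₀} = T₀(B₁)`. -/
theorem stmt19 (c : KK) (hc : c ≠ 0) (Φ T0 : QOns c ≃ₐ[KK] QOns c)
    (hΦ0 : Φ (Bo c) = Bi c) (hΦ1 : Φ (Bi c) = Bo c)
    (hT00 : T0 (Bo c) = Bo c) (hT01 : T0 (Bi c) = T0B1val c)
    (n : ℕ) (hn : 3 ≤ n)
    (hcom : ∀ k, 1 ≤ k → k < n → Bdel c * Bim c Φ T0 (k) - Bim c Φ T0 (k) * Bdel c = 0)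
    (hB0 : ∀ m' : ℕ, 1 ≤ m' → m' < n → Bim c Φ T0 (m') * Bo c - Bo c * Bim c Φ T0 (m') = (c * (qq + qq⁻¹) * (qq⁻¹) ^ (2 * (m' - 1))) • (Ba0 c Φ T0 (m') - Ba1 c Φ T0 (m' - 1)) + ∑ p ∈ Finset.Icc 1 (m' - 1), (-(qq ^ 4 - 1) * (qq⁻¹) ^ (2 * p)) • (Ba0 c Φ T0 (p) * Bim c Φ T0 (m' - p) - Bim c Φ T0 (m' - p) * Ba1 c Φ T0 (p - 1))) :
    Bim c Φ T0 (n) * Bo c - Bo c * Bim c Φ T0 (n) =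
      ((qq⁻¹) ^ 2) • (Bim c Φ T0 (n - 1) * T0 (Bi c) - T0 (Bi c) * Bim c Φ T0 (n - 1))
        - (Bim c Φ T0 (n - 2) * Bo c - Bo c * Bim c Φ T0 (n - 2))
        - ((qq⁻¹) ^ 2) • (Bi c * Bim c Φ T0 (n - 1) - Bim c Φ T0 (n - 1) * Bi c)
        + (qq ^ 2 - (qq⁻¹) ^ 2) • (Bim c Φ T0 (n - 1) * Bi c - T0 (Bi c) * Bim c Φ T0 (n - 1)) := by
  set t : KK := (qq⁻¹) ^ 2 with ht
  set τ : QOns c ≃ₐ[KK] QOns c := Φ.trans T0 with hτ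
  have hτa : ∀ y, τ y = T0 (Φ y) := fun y => rfl
  have hσa : ∀ y, (T1def c Φ T0).symm (Φ y) = τ.symm y := by
    intro y
    simp [T1def, hτ]
  have hBa1s : ∀ k, Ba1 c Φ T0 (k+1) = τ.symm (Ba1 c Φ T0 k) := by
    intro k
    rw [Ba1, Function.iterate_succ_apply', Function.comp_apply, hσa]; rfl
  have hBa0s : ∀ k, Ba0 c Φ T0 (k+1) = τ (Ba0 c Φ T0 k) := by
    intro k
    rw [Ba0, Function.iterate_succ_apply', Function.comp_apply]; rfl
  have hτ1 : τ (Bi c) = Bo c := by rw [hτa, hΦ1, hT00]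
  have hτ0 : τ (Bo c) = T0 (Bi c) := by rw [hτa, hΦ0]
  let x : ℤ → QOns c := Ba1Z c Φ T0
  have hxn : ∀ k : ℕ, x (k : ℤ) = Ba1 c Φ T0 k := by
    intro k
    simp [x, Ba1Z]
  have hx0 : x 0 = Bi c := hxn 0
  have hxneg : ∀ k : ℕ, x (-(k : ℤ) - 1) = Ba0 c Φ T0 k := by
    intro k
    have h1 : ¬ (0 ≤ -(k:ℤ) - 1) := by omega
    have h2 : (-(-(k:ℤ) - 1) - 1).toNat = k := by omega
    simp only [x, Ba1Z, if_neg h1, h2]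
  have hxm1 : x (-1) = Bo c := by
    have := hxneg 0
    simp only [Nat.cast_zero, neg_zero, zero_sub] at this
    exact this
  have hσ : ∀ k, τ.symm (x k) = x (k + 1) := by
    intro k
    rcases lt_or_ge k 0 with hk | hk
    · obtain ⟨j, rfl⟩ : ∃ j : ℕ, k = -(j:ℤ) - 1 := ⟨(-k-1).toNat, by omega⟩
      rcases j with _ | j
      · rw [AlgEquiv.symm_apply_eq]
        simp only [Nat.cast_zero, neg_zero, zero_sub, hxm1]
        norm_num
        rw [hx0, hτ1]
      · have e : -((j+1 : ℕ):ℤ) - 1 + 1 = -(j:ℤ) - 1 := by push_cast; ring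
        rw [AlgEquiv.symm_apply_eq, e, hxneg, hxneg, hBa0s]
    · obtain ⟨j, rfl⟩ : ∃ j : ℕ, k = j := ⟨k.toNat, by omega⟩
      have e : (j:ℤ) + 1 = ((j+1:ℕ):ℤ) := by push_cast; ring
      rw [e, hxn, hxn, hBa1s]
  have hxm2 : x (-2) = T0 (Bi c) := by
    have := hσ (-2)
    rw [AlgEquiv.symm_apply_eq] at this
    norm_num at this
    rw [this, hxm1, hτ0]
  have hτd : τ (Bdel c) = Bdel c := by
    have h := tau_del_aux qq qq_ne qq_sum_ne c hc (Bo c) (Bi c) (rel0 c) _ (hT01.trans rfl)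
    simp only [Bdel, map_add, map_neg, map_mul, map_smul, hτ1, hτ0]
    exact h
  have hσd : τ.symm (Bdel c) = Bdel c := by rw [AlgEquiv.symm_apply_eq, hτd]
  have hd0 : Bdel c * x (-1) - x (-1) * Bdel c = (c * (qq + qq⁻¹)) • (x (-2) - x 0) := by
    rw [hxm1, hxm2, hx0]
    exact del_aux qq qq_ne qq_sum_ne c hc (Bo c) (Bi c) _ (hT01.trans rfl)
  have hd : ∀ k, Bdel c * x k - x k * Bdel c = (c * (qq + qq⁻¹)) • (x (k - 1) - x (k + 1)) := by
    have up : ∀ k, (Bdel c * x k - x k * Bdel c = (c * (qq + qq⁻¹)) • (x (k - 1) - x (k + 1)))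
        ↔ (Bdel c * x (k+1) - x (k+1) * Bdel c = (c * (qq + qq⁻¹)) • (x (k + 1 - 1) - x (k + 1 + 1))) := by
      intro k
      rw [← τ.symm.injective.eq_iff]
      simp only [map_sub, map_mul, map_smul, hσ, hσd]
      have e : k - 1 + 1 = k + 1 - 1 := by ring
      rw [e]
    intro k
    induction k using Int.induction_on with
    | zero => exact (up (-1)).mp (by simpa using hd0)
    | succ i ih => exact (up _).mp ih
    | pred i ih => exact (up _).mpr (by simpa using ih)
  let F : ℕ → QOns c := fun k => if k = 0 then 0 else Bim c Φ T0 k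
  have hFp : ∀ k, 1 ≤ k → F k = Bim c Φ T0 k := by
    intro k hk
    simp only [F]; rw [if_neg (by omega)]
  have hF0 : F 0 = 0 := by simp [F]
  have hF1' : F 1 = Bdel c := by
    rw [hFp 1 le_rfl]
    simp [Bim, CC, Bdel, Ba1]
  have hF1 : (2 : KK) • F 1 = SS t x (-1) 0 := by
    rw [hF1']
    simp only [SS, Bdel, zero_sub, neg_add_cancel, hx0, hxm1]
    exact F1_aux _ _ _
  have hF : ∀ m : ℕ, F (m + 2) = SS t x (-1) ((m : ℤ) + 1) + τ.symm (F m) := by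
    intro m
    rw [hFp (m+2) (by omega)]
    have e1 : (m:ℤ) + 1 = ((m+1:ℕ):ℤ) := by push_cast; ring
    have e2 : (-1:ℤ) + 1 = 0 := by norm_num
    have e3 : ((m+1:ℕ):ℤ) - 1 = (m:ℤ) := by push_cast; ring
    have hB0 : Ba1 c Φ T0 0 = Bi c := rfl
    rcases m with _ | m
    · simp only [hF0, map_zero, add_zero, SS, Bim, CC, e1, e2, e3, hxn, hx0, hxm1]
      simp only [hB0, zero_add, Nat.reduceAdd, Nat.reduceSub, Finset.sum_range_one, Nat.sub_self, tsub_zero]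
      refine F2_aux t _ _ _
    · rw [hFp (m+1) (by omega)]
      have hC := C_rec (Ba1 c Φ T0) m
      have hBo : τ.symm (Bo c) = Bi c := by rw [AlgEquiv.symm_apply_eq, hτ1]
      simp only [SS, Bim, CC, e1, e2, e3, hxn, hx0, hxm1, map_add, map_neg, map_smul, map_mul,
        map_sum, ← hBa1s, hBo, hB0] at hC ⊢
      have f1 : m + 1 + 2 - 1 = m + 2 := by omega
      have f2 : m + 1 + 2 - 2 = m + 1 := by omega
      have f3 : m + 1 - 1 = m := by omega
      have f4 : m + 1 - 2 = m - 1 := by omega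
      simp only [f1, f2, f3, f4, hC]
      have f5 : m + 1 + 1 = m + 2 := rfl
      simp only [f5]
      refine F3_aux t _ _ _ _ _
  have hσ1 : τ.symm (F 1) = F 1 := by rw [hF1', hσd]
  have main := abstract_main t (c * (qq + qq⁻¹)) (mul_ne_zero hc qq_sum_ne) x τ.symm (Bdel c) F n hn
    hσ hd hF0 hF1 hF hσ1 (fun k h1 h2 => by rw [hFp k h1]; exact hcom k h1 h2)
  rw [hFp n (by omega), hFp (n-1) (by omega), hFp (n-2) (by omega), hxm1, hxm2, hx0] at main
  have hut : qq ^ 2 * t = 1 := by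
    rw [ht, ← mul_pow, mul_inv_cancel₀ qq_ne, one_pow]
  exact fin_aux _ _ hut _ _ _ _ _ _ main


end
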